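/- Let A = [a_{ij}] be an n×n real symmetric positive semidefinite matrix and consider the Schur (entrywise) product map D_A : ℋⁿ → ℋⁿ defined by (D_A(X))_{ij} = a_{ij}x_{ij} for X = [x_{ij}] ∈ ℋⁿ. Then λ(|D_A(X)|) ≺_w (diag A)↓ * λ(|X|) for all X ∈ ℋⁿ, where (diag A)↓ is the vector of diagonal entries of A arranged in decreasing order, and (diag A)↓ is the least vector of D_A. -/

import Mathlib

open Matrix
open scoped ComplexOrder

/-- Sum of the `k` largest entries of `p` (as a supremum of sums over `k`-subsets). -/
noncomputable def sumLargest {n : ℕ} (p : Fin n → ℝ) (k : ℕ) : ℝ :=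
  sSup ((fun A : Finset (Fin n) => ∑ i ∈ A, p i) '' {A : Finset (Fin n) | A.card = k})

/-- `p` is weakly majorized by `q`. -/
def WeakMaj {n : ℕ} (p q : Fin n → ℝ) : Prop :=
  ∀ k : ℕ, 1 ≤ k → k ≤ n → sumLargest p k ≤ sumLargest q k

/-- `p` is majorized by `q`. -/
def Maj {n : ℕ} (p q : Fin n → ℝ) : Prop :=
  WeakMaj p q ∧ ∑ i, p i = ∑ i, q i

/-- `p` has nonnegative entries arranged in decreasing order. -/
def DecrNonneg {n : ℕ} (p : Fin n → ℝ) : Prop :=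
  Antitone p ∧ ∀ i, 0 ≤ p i

/-- The decreasing rearrangement of a vector. -/
noncomputable def decrRearrange {n : ℕ} (p : Fin n → ℝ) : Fin n → ℝ :=
  fun i => p (Tuple.sort p (Fin.rev i))

/-- `x` is the supremum of `S` in the weak-majorization order (w-sup). -/
def IsWSup {n : ℕ} (S : Set (Fin n → ℝ)) (x : Fin n → ℝ) : Prop :=
  DecrNonneg x ∧ (∀ s ∈ S, WeakMaj s x) ∧
    ∀ p : Fin n → ℝ, (∀ i, 0 ≤ p i) → (∀ s ∈ S, WeakMaj s p) → WeakMaj x p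

/-- `x` is the infimum of `Q` in the weak-majorization order (w-inf). -/
def IsWInf {n : ℕ} (Q : Set (Fin n → ℝ)) (x : Fin n → ℝ) : Prop :=
  DecrNonneg x ∧ (∀ q ∈ Q, WeakMaj x q) ∧
    ∀ p : Fin n → ℝ, (∀ i, 0 ≤ p i) → (∀ q ∈ Q, WeakMaj p q) → WeakMaj p x

open Classical in
/-- The vector of eigenvalues of a Hermitian matrix, in decreasing order
(junk value `0` if the matrix is not Hermitian). -/
noncomputable def specVec {n : ℕ} (X : Matrix (Fin n) (Fin n) ℂ) : Fin n → ℝ :=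
  if h : X.IsHermitian then decrRearrange h.eigenvalues else 0

open Classical in
/-- `λ(|X|)`: the absolute values of the eigenvalues of a Hermitian matrix `X`,
in decreasing order. -/
noncomputable def absSpecVec {n : ℕ} (X : Matrix (Fin n) (Fin n) ℂ) : Fin n → ℝ :=
  if h : X.IsHermitian then decrRearrange (fun i => |h.eigenvalues i|) else 0

/-- The Jordan product `X ∘ Y = (XY + YX)/2`. -/
noncomputable def jmul {n : ℕ} (X Y : Matrix (Fin n) (Fin n) ℂ) : Matrix (Fin n) (Fin n) ℂ :=
  (2 : ℂ)⁻¹ • (X * Y + Y * X)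

/-- A nonzero (orthogonal) projection in `ℋⁿ`. -/
def IsProjection {n : ℕ} (P : Matrix (Fin n) (Fin n) ℂ) : Prop :=
  P.IsHermitian ∧ P * P = P ∧ P ≠ 0

/-- An involution in `ℋⁿ`: a Hermitian matrix with `ε² = I`. -/
def IsInvolution {n : ℕ} (ε : Matrix (Fin n) (Fin n) ℂ) : Prop :=
  ε.IsHermitian ∧ ε * ε = 1

/-- A positive map: maps positive semidefinite matrices to positive semidefinite matrices. -/
def PositiveMap {n : ℕ} (T : Matrix (Fin n) (Fin n) ℂ → Matrix (Fin n) (Fin n) ℂ) : Prop :=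
  ∀ X : Matrix (Fin n) (Fin n) ℂ, X.PosSemidef → (T X).PosSemidef

/-- `S` is the adjoint of `T` with respect to the trace inner product on `ℋⁿ`. -/
def IsAdjointOf {n : ℕ} (S T : Matrix (Fin n) (Fin n) ℂ → Matrix (Fin n) (Fin n) ℂ) : Prop :=
  ∀ X Y : Matrix (Fin n) (Fin n) ℂ, X.IsHermitian → Y.IsHermitian →
    Matrix.trace (T X * Y) = Matrix.trace (X * S Y)

/-- `q` is the least vector of `T`: `λ(|T(X)|) ≺_w q * λ(|X|)` for all Hermitian `X`,
and `q ≺_w q'` for any other `q' ∈ (ℝⁿ₊)↓` with the same property. -/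
def IsLeastVector {n : ℕ} (T : Matrix (Fin n) (Fin n) ℂ → Matrix (Fin n) (Fin n) ℂ)
    (q : Fin n → ℝ) : Prop :=
  DecrNonneg q ∧
  (∀ X : Matrix (Fin n) (Fin n) ℂ, X.IsHermitian →
    WeakMaj (absSpecVec (T X)) (q * absSpecVec X)) ∧
  ∀ q' : Fin n → ℝ, DecrNonneg q' →
    (∀ X : Matrix (Fin n) (Fin n) ℂ, X.IsHermitian →
      WeakMaj (absSpecVec (T X)) (q' * absSpecVec X)) → WeakMaj q q'

open Finset in
theorem sum_mul_nonneg_of_prefix_nonneg {n : ℕ} (m d : Fin n → ℝ) (hm : Antitone m)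
    (hm0 : ∀ i, 0 ≤ m i) (hd : ∀ r ≤ n, 0 ≤ ∑ j : Fin n, if j.val < r then d j else 0) :
    0 ≤ ∑ j, d j * m j := by
  induction n with
  | zero => simp
  | succ n ih =>
    have key : ∑ j, d j * m j =
        ∑ j : Fin n, d j.castSucc * (m j.castSucc - m (Fin.last n)) +
          m (Fin.last n) * ∑ j, d j := by
      rw [Fin.sum_univ_castSucc, Fin.sum_univ_castSucc (f := d), mul_add, mul_sum]
      simp only [mul_sub, sum_sub_distrib]
      simp only [mul_comm (m (Fin.last n))]
      ring
    rw [key]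
    refine add_nonneg (ih (fun j => m j.castSucc - m (Fin.last n)) (fun j => d j.castSucc)
      (fun i j hij => sub_le_sub_right (hm (Fin.castSucc_le_castSucc_iff.2 hij)) _)
      (fun i => sub_nonneg.2 (hm (Fin.le_last _))) fun r hr => ?_)
      (mul_nonneg (hm0 _) ?_)
    · have h := hd r (hr.trans n.le_succ)
      rw [Fin.sum_univ_castSucc] at h
      simpa [hr.not_gt] using h
    · simpa only [Fin.is_lt, if_true] using hd (n + 1) le_rfl

theorem sum_mul_le_sum_mul_of_prefix_le {n : ℕ} (m c b : Fin n → ℝ) (hm : Antitone m)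
    (hm0 : ∀ i, 0 ≤ m i)
    (h : ∀ r ≤ n, ∑ j : Fin n, (if j.val < r then c j else 0) ≤
      ∑ j : Fin n, if j.val < r then b j else 0) :
    ∑ j, c j * m j ≤ ∑ j, b j * m j := by
  have := sum_mul_nonneg_of_prefix_nonneg m (fun j => b j - c j) hm hm0 fun r hr => by
    have h1 := h r hr
    rw [← sub_nonneg, ← Finset.sum_sub_distrib] at h1
    refine h1.trans_eq (Finset.sum_congr rfl fun j _ => ?_)
    split_ifs <;> simp
  simpa [sub_mul] using this

theorem sum_ite_val_lt {n k : ℕ} (hk : k ≤ n) :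
    ∑ j : Fin n, (if j.val < k then (1 : ℝ) else 0) = k := by
  simp [Fin.card_filter_val_lt, hk]

theorem card_filter_val_lt_eq {n k : ℕ} (hk : k ≤ n) :
    (Finset.univ.filter fun j : Fin n => j.val < k).card = k := by
  simp [Fin.card_filter_val_lt, hk]

theorem decrRearrange_antitone {n : ℕ} (p : Fin n → ℝ) : Antitone (decrRearrange p) :=
  fun _ _ h => Tuple.monotone_sort p (Fin.rev_le_rev.2 h)

theorem exists_perm_decrRearrange {n : ℕ} (p : Fin n → ℝ) :
    ∃ σ : Equiv.Perm (Fin n), ∀ i, decrRearrange p i = p (σ i) :=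
  ⟨Fin.revPerm.trans (Tuple.sort p), fun _ => rfl⟩

theorem decrRearrange_nonneg {n : ℕ} {p : Fin n → ℝ} (hp : ∀ i, 0 ≤ p i) (i : Fin n) :
    0 ≤ decrRearrange p i :=
  hp _

theorem sum_le_sumLargest {n : ℕ} (p : Fin n → ℝ) {k : ℕ} (S : Finset (Fin n))
    (hS : S.card = k) : ∑ i ∈ S, p i ≤ sumLargest p k :=
  le_csSup (Set.toFinite _).bddAbove ⟨S, hS, rfl⟩

theorem sumLargest_le {n : ℕ} (p : Fin n → ℝ) {k : ℕ} (hk : k ≤ n) {b : ℝ}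
    (h : ∀ S : Finset (Fin n), S.card = k → ∑ i ∈ S, p i ≤ b) : sumLargest p k ≤ b := by
  refine csSup_le ⟨_, _, card_filter_val_lt_eq hk, rfl⟩ ?_
  rintro _ ⟨S, hS, rfl⟩
  exact h S hS

theorem sumLargest_decrRearrange_le {n : ℕ} (p : Fin n → ℝ) {k : ℕ} (hk : k ≤ n) {b : ℝ}
    (h : ∀ S : Finset (Fin n), S.card = k → ∑ i ∈ S, p i ≤ b) :
    sumLargest (decrRearrange p) k ≤ b := by
  obtain ⟨σ, hσ⟩ := exists_perm_decrRearrange p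
  refine sumLargest_le _ hk fun S hS => ?_
  simpa [hσ] using h (S.map σ.toEmbedding) (by simpa using hS)

theorem sum_ite_le_sumLargest {n : ℕ} (p : Fin n → ℝ) {k : ℕ} (hk : k ≤ n) :
    ∑ j : Fin n, (if j.val < k then p j else 0) ≤ sumLargest p k := by
  rw [← Finset.sum_filter]
  exact sum_le_sumLargest p _ (card_filter_val_lt_eq hk)

theorem sum_doublyStochastic_le {n : ℕ} (a : Fin n → ℝ) (ha : ∀ i, 0 ≤ a i)
    (W : Fin n → Fin n → ℝ) (hW : ∀ i j, 0 ≤ W i j) (hrow : ∀ i, ∑ j, W i j = 1)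
    (hcol : ∀ j, ∑ i, W i j = 1) (S : Finset (Fin n)) :
    ∑ i ∈ S, ∑ q, a q * W i q ≤
      ∑ j : Fin n, if j.val < S.card then decrRearrange a j else 0 := by
  obtain ⟨σ, hσ⟩ := exists_perm_decrRearrange a
  have hSn : S.card ≤ n := by simpa using S.card_le_univ
  have hle : ∀ q, ∑ i ∈ S, W i q ≤ 1 := fun q => (hcol q) ▸
    Finset.sum_le_sum_of_subset_of_nonneg S.subset_univ fun i _ _ => hW i q
  have hnn : ∀ q, 0 ≤ ∑ i ∈ S, W i q := fun q => Finset.sum_nonneg fun i _ => hW i q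
  calc ∑ i ∈ S, ∑ q, a q * W i q
      = ∑ q, (∑ i ∈ S, W i q) * a q := by
        rw [Finset.sum_comm]
        simp only [← Finset.mul_sum, mul_comm]
    _ = ∑ q, (∑ i ∈ S, W i (σ q)) * decrRearrange a q := by
        simp only [hσ]
        exact (Equiv.sum_comp σ fun q => (∑ i ∈ S, W i q) * a q).symm
    _ ≤ ∑ q : Fin n, (if q.val < S.card then 1 else 0) * decrRearrange a q := by
        refine sum_mul_le_sum_mul_of_prefix_le _ _ _ (decrRearrange_antitone a)
          (decrRearrange_nonneg ha) fun r hr => ?_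
        rcases le_total r S.card with h | h
        · refine Finset.sum_le_sum fun j _ => ?_
          split_ifs with h1 h2
          · exact hle _
          · omega
          · exact le_rfl
        · calc ∑ j : Fin n, (if j.val < r then ∑ i ∈ S, W i (σ j) else 0)
              ≤ ∑ j : Fin n, ∑ i ∈ S, W i (σ j) := by
                refine Finset.sum_le_sum fun j _ => ?_
                split_ifs
                · exact le_rfl
                · exact hnn _
            _ = S.card := by
                rw [Equiv.sum_comp σ fun j => ∑ i ∈ S, W i j, Finset.sum_comm]
                simp [hrow]
            _ = ∑ j : Fin n, (if j.val < S.card then (1 : ℝ) else 0) :=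
                (sum_ite_val_lt hSn).symm
            _ ≤ _ := by
                refine Finset.sum_le_sum fun j _ => ?_
                split_ifs <;> first | omega | simp
    _ = _ := by simp

theorem sum_mul_sum_le_sumLargest {n : ℕ} (a m : Fin n → ℝ) (ha : ∀ i, 0 ≤ a i)
    (hm : ∀ i, 0 ≤ m i) (M W W' : Fin n → Fin n → ℝ) (hM : ∀ i j, 0 ≤ M i j)
    (hW : ∀ i j, 0 ≤ W i j) (hrow : ∀ i, ∑ j, W i j = 1) (hcol : ∀ j, ∑ i, W i j = 1)
    (hW' : ∀ i j, 0 ≤ W' i j) (hrow' : ∀ i, ∑ j, W' i j = 1) (hcol' : ∀ j, ∑ i, W' i j = 1)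
    (hMW : ∀ i, ∑ l, M i l = ∑ q, a q * W i q) (hMW' : ∀ l, ∑ i, M i l = ∑ q, a q * W' l q)
    (S : Finset (Fin n)) :
    ∑ i ∈ S, ∑ l, m l * M i l ≤ sumLargest (decrRearrange a * decrRearrange m) S.card := by
  obtain ⟨τ, hτ⟩ := exists_perm_decrRearrange m
  have hSn : S.card ≤ n := by simpa using S.card_le_univ
  have hnn : ∀ l, 0 ≤ ∑ i ∈ S, M i l := fun l => Finset.sum_nonneg fun i _ => hM i l
  calc ∑ i ∈ S, ∑ l, m l * M i l
      = ∑ l, (∑ i ∈ S, M i l) * m l := by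
        rw [Finset.sum_comm]
        simp only [← Finset.mul_sum, mul_comm]
    _ = ∑ l, (∑ i ∈ S, M i (τ l)) * decrRearrange m l := by
        simp only [hτ]
        exact (Equiv.sum_comp τ fun l => (∑ i ∈ S, M i l) * m l).symm
    _ ≤ ∑ l : Fin n, (if l.val < S.card then decrRearrange a l else 0) * decrRearrange m l := by
        refine sum_mul_le_sum_mul_of_prefix_le _ _ _ (decrRearrange_antitone m)
          (decrRearrange_nonneg hm) fun r hr => ?_
        rcases le_total r S.card with h | h
        · calc ∑ j : Fin n, (if j.val < r then ∑ i ∈ S, M i (τ j) else 0)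
              = ∑ l ∈ (Finset.univ.filter fun j : Fin n => j.val < r).map τ.toEmbedding,
                  ∑ i ∈ S, M i l := by
                rw [← Finset.sum_filter, Finset.sum_map]
                rfl
            _ ≤ ∑ l ∈ (Finset.univ.filter fun j : Fin n => j.val < r).map τ.toEmbedding,
                  ∑ q, a q * W' l q := by
                refine Finset.sum_le_sum fun l _ => ?_
                rw [← hMW']
                exact Finset.sum_le_sum_of_subset_of_nonneg S.subset_univ fun i _ _ => hM i l
            _ ≤ _ := sum_doublyStochastic_le a ha W' hW' hrow' hcol' _
            _ = ∑ j : Fin n, (if j.val < r then decrRearrange a j else 0) := by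
                rw [Finset.card_map, card_filter_val_lt_eq hr]
            _ = _ := by
                refine Finset.sum_congr rfl fun j _ => ?_
                split_ifs <;> first | omega | rfl
        · calc ∑ j : Fin n, (if j.val < r then ∑ i ∈ S, M i (τ j) else 0)
              ≤ ∑ j : Fin n, ∑ i ∈ S, M i (τ j) := by
                refine Finset.sum_le_sum fun j _ => ?_
                split_ifs
                · exact le_rfl
                · exact hnn _
            _ = ∑ i ∈ S, ∑ q, a q * W i q := by
                rw [Equiv.sum_comp τ fun j => ∑ i ∈ S, M i j, Finset.sum_comm]
                simp only [hMW]
            _ ≤ _ := sum_doublyStochastic_le a ha W hW hrow hcol S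
            _ = _ := by
                refine Finset.sum_congr rfl fun j _ => ?_
                split_ifs <;> first | omega | rfl
    _ = ∑ l : Fin n, if l.val < S.card then (decrRearrange a * decrRearrange m) l else 0 := by
        refine Finset.sum_congr rfl fun l _ => ?_
        split_ifs <;> simp
    _ ≤ _ := sum_ite_le_sumLargest _ hSn

theorem sum_norm_sq_row {n : ℕ} (U : Matrix.unitaryGroup (Fin n) ℂ) (p : Fin n) :
    ∑ i, ‖U.1 p i‖ ^ 2 = 1 := by
  have h := congrFun (congrFun (Matrix.mem_unitaryGroup_iff.1 U.2) p) p
  rw [Matrix.mul_apply] at h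
  simp only [Matrix.star_apply, RCLike.star_def, Complex.mul_conj', Matrix.one_apply_eq] at h
  exact_mod_cast h

theorem sum_norm_sq_col {n : ℕ} (U : Matrix.unitaryGroup (Fin n) ℂ) (i : Fin n) :
    ∑ p, ‖U.1 p i‖ ^ 2 = 1 := by
  have h := congrFun (congrFun (Matrix.mem_unitaryGroup_iff'.1 U.2) i) i
  rw [Matrix.mul_apply] at h
  simp only [Matrix.star_apply, RCLike.star_def, Complex.conj_mul', Matrix.one_apply_eq] at h
  exact_mod_cast h

theorem sum_norm_sq_mul_unitary {n : ℕ} (V : Matrix.unitaryGroup (Fin n) ℂ) (x : Fin n → ℂ) :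
    ∑ l, ‖∑ p, x p * star (V.1 p l)‖ ^ 2 = ∑ p, ‖x p‖ ^ 2 := by
  have hV : ∀ p q, ∑ l, star (V.1 p l) * V.1 q l = if q = p then 1 else 0 := fun p q => by
    have h := congrFun (congrFun (Matrix.mem_unitaryGroup_iff.1 V.2) q) p
    rw [Matrix.mul_apply, Matrix.one_apply] at h
    simpa only [Matrix.star_apply, mul_comm] using h
  have : ((∑ l, ‖∑ p, x p * star (V.1 p l)‖ ^ 2 : ℝ) : ℂ) = ((∑ p, ‖x p‖ ^ 2 : ℝ) : ℂ) := by
    push_cast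
    simp only [← Complex.mul_conj', map_sum, Finset.sum_mul_sum]
    rw [Finset.sum_comm]
    refine Finset.sum_congr rfl fun p _ => ?_
    rw [Finset.sum_comm]
    have h2 : ∀ q, ∑ l, x p * star (V.1 p l) * (starRingEnd ℂ) (x q * star (V.1 q l)) =
        x p * (starRingEnd ℂ) (x q) * if q = p then 1 else 0 := fun q => by
      rw [← hV, Finset.mul_sum]
      refine Finset.sum_congr rfl fun l _ => ?_
      simp
      ring
    simp only [h2]
    simp [Complex.mul_conj']
  exact_mod_cast this

/-- The quantities `⟨u_i, D_A(v_l v_l^*) u_i⟩` for the columns of `U` and `V`, where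
`A = ∑ s, v_s v_s^T`. -/
noncomputable def schurWeight {n N : ℕ} (v : Fin N → Fin n → ℝ)
    (U V : Matrix (Fin n) (Fin n) ℂ) (i l : Fin n) : ℝ :=
  ∑ s, ‖∑ p, v s p * U p i * star (V p l)‖ ^ 2

theorem schurWeight_comm {n N : ℕ} (v : Fin N → Fin n → ℝ)
    (U V : Matrix (Fin n) (Fin n) ℂ) (i l : Fin n) :
    schurWeight v U V i l = schurWeight v V U l i := by
  refine Finset.sum_congr rfl fun s _ => ?_
  rw [← norm_star]
  congr 2
  simp [mul_assoc, mul_comm]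

theorem sum_schurWeight {n N : ℕ} (v : Fin N → Fin n → ℝ)
    (U : Matrix (Fin n) (Fin n) ℂ) (V : Matrix.unitaryGroup (Fin n) ℂ) (i : Fin n) :
    ∑ l, schurWeight v U V.1 i l = ∑ q, (∑ s, v s q * v s q) * ‖U q i‖ ^ 2 := by
  unfold schurWeight
  rw [Finset.sum_comm]
  simp only [sum_norm_sq_mul_unitary V fun p => _, Finset.sum_mul]
  rw [Finset.sum_comm]
  refine Finset.sum_congr rfl fun q _ => Finset.sum_congr rfl fun s _ => ?_
  rw [norm_mul, mul_pow, Complex.norm_real, Real.norm_eq_abs, sq_abs, sq (v s q)]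

theorem Matrix.IsHermitian.apply_eq_sum_eigenvalues {n : ℕ} {X : Matrix (Fin n) (Fin n) ℂ}
    (hX : X.IsHermitian) (p q : Fin n) :
    X p q = ∑ l, (hX.eigenvalues l : ℂ) *
      (hX.eigenvectorUnitary.1 p l * star (hX.eigenvectorUnitary.1 q l)) := by
  conv_lhs => rw [hX.spectral_theorem, Unitary.conjStarAlgAut_apply, Matrix.mul_apply]
  refine Finset.sum_congr rfl fun l _ => ?_
  rw [Matrix.mul_diagonal, Matrix.star_apply]
  simp only [Function.comp, Complex.coe_algebraMap]
  ring

theorem Matrix.IsHermitian.eigenvalues_eq_sum {n : ℕ} {Y : Matrix (Fin n) (Fin n) ℂ}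
    (hY : Y.IsHermitian) (i : Fin n) :
    (hY.eigenvalues i : ℂ) = ∑ p, ∑ q, star (hY.eigenvectorUnitary.1 p i) * Y p q *
      hY.eigenvectorUnitary.1 q i := by
  have h := congrFun (congrFun hY.conjStarAlgAut_star_eigenvectorUnitary i) i
  rw [Unitary.conjStarAlgAut_star_apply, Matrix.mul_apply, Matrix.diagonal_apply_eq] at h
  simp only [Matrix.mul_apply, Finset.sum_mul, Matrix.star_apply] at h
  rw [Finset.sum_comm]
  exact h.symm

theorem eigenvalues_schur_eq {n N : ℕ} (v : Fin N → Fin n → ℝ)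
    {X Y : Matrix (Fin n) (Fin n) ℂ} (hX : X.IsHermitian) (hY : Y.IsHermitian)
    (hXY : ∀ p q, Y p q = ((∑ s, v s p * v s q : ℝ) : ℂ) * X p q) (i : Fin n) :
    hY.eigenvalues i = ∑ l, hX.eigenvalues l *
      schurWeight v hY.eigenvectorUnitary.1 hX.eigenvectorUnitary.1 i l := by
  apply Complex.ofReal_injective
  rw [hY.eigenvalues_eq_sum]
  simp only [hXY, hX.apply_eq_sum_eigenvalues]
  generalize hY.eigenvectorUnitary.1 = U
  generalize hX.eigenvectorUnitary.1 = V
  calc ∑ p, ∑ q, star (U p i) * (((∑ s, v s p * v s q : ℝ) : ℂ) *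
        ∑ l, (hX.eigenvalues l : ℂ) * (V p l * star (V q l))) * U q i
      = ∑ p, ∑ q, ∑ l, ∑ s, (hX.eigenvalues l : ℂ) *
          (star (v s p * U p i * star (V p l)) * (v s q * U q i * star (V q l))) := by
        refine Finset.sum_congr rfl fun p _ => Finset.sum_congr rfl fun q _ => ?_
        push_cast
        rw [Finset.sum_mul_sum, Finset.sum_comm, Finset.mul_sum, Finset.sum_mul]
        refine Finset.sum_congr rfl fun l _ => ?_
        rw [Finset.mul_sum, Finset.sum_mul]
        refine Finset.sum_congr rfl fun s _ => ?_
        simp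
        ring
    _ = ∑ l, ∑ s, ∑ p, ∑ q, (hX.eigenvalues l : ℂ) *
          (star (v s p * U p i * star (V p l)) * (v s q * U q i * star (V q l))) :=
        (Finset.sum_congr rfl fun p _ => Finset.sum_comm).trans <| Finset.sum_comm.trans <|
          Finset.sum_congr rfl fun l _ =>
            (Finset.sum_congr rfl fun p _ => Finset.sum_comm).trans Finset.sum_comm
    _ = _ := by
        unfold schurWeight
        push_cast
        simp only [← Complex.conj_mul', map_sum, Finset.sum_mul_sum, RCLike.star_def]
        simp only [Finset.mul_sum]

theorem weakMaj_absSpecVec_schur {n : ℕ} {A : Matrix (Fin n) (Fin n) ℝ} (hA : A.PosSemidef)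
    {X : Matrix (Fin n) (Fin n) ℂ} (hX : X.IsHermitian) :
    WeakMaj (absSpecVec (Matrix.of fun i j => (A i j : ℂ) * X i j))
      (decrRearrange (fun i => A i i) * absSpecVec X) := by
  intro k _ hk
  have hY : (Matrix.of fun i j => (A i j : ℂ) * X i j).IsHermitian := by
    ext i j
    have h1 := hA.1.apply i j
    have h2 := hX.apply i j
    simp only [star_trivial] at h1
    simp only [Matrix.conjTranspose_apply, Matrix.of_apply, star_mul', h2, h1]
    simp
  rw [absSpecVec, absSpecVec, dif_pos hX, dif_pos hY]
  obtain ⟨N, v, hv⟩ := Matrix.posSemidef_iff_eq_sum_vecMulVec.1 hA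
  have hAv : ∀ p q, A p q = ∑ s, v s p * v s q := fun p q => by
    simp [hv, Matrix.sum_apply, Matrix.vecMulVec_apply]
  have hM : ∀ i l, 0 ≤ schurWeight v hY.eigenvectorUnitary.1 hX.eigenvectorUnitary.1 i l :=
    fun i l => Finset.sum_nonneg fun s _ => by positivity
  refine sumLargest_decrRearrange_le _ hk fun S hS => ?_
  subst hS
  refine le_trans (Finset.sum_le_sum fun i _ => ?_)
    (sum_mul_sum_le_sumLargest (fun i => A i i) (fun l => |hX.eigenvalues l|)
      (fun i => hA.diag_nonneg) (fun l => abs_nonneg _)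
      (schurWeight v hY.eigenvectorUnitary.1 hX.eigenvectorUnitary.1)
      (fun i q => ‖hY.eigenvectorUnitary.1 q i‖ ^ 2)
      (fun i q => ‖hX.eigenvectorUnitary.1 q i‖ ^ 2) hM
      (fun _ _ => by positivity) (sum_norm_sq_col _) (sum_norm_sq_row _)
      (fun _ _ => by positivity) (sum_norm_sq_col _) (sum_norm_sq_row _)
      (fun i => by simp only [sum_schurWeight, hAv])
      (fun l => by
        simp only [hAv]
        rw [← sum_schurWeight]
        exact Finset.sum_congr rfl fun i _ => schurWeight_comm v _ _ i l)
      S)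
  rw [eigenvalues_schur_eq v hX hY (fun p q => by rw [Matrix.of_apply, hAv]) i]
  refine (Finset.abs_sum_le_sum_abs _ _).trans_eq (Finset.sum_congr rfl fun l _ => ?_)
  rw [abs_mul, abs_of_nonneg (hM i l)]

theorem weakMaj_absSpecVec_diagonal {n : ℕ} (a : Fin n → ℝ) :
    WeakMaj (decrRearrange a) (absSpecVec (Matrix.diagonal fun i => (a i : ℂ))) := by
  intro k _ hk
  have hD : (Matrix.diagonal fun i => (a i : ℂ)).IsHermitian :=
    Matrix.isHermitian_diagonal_iff.2 fun i => by simp [isSelfAdjoint_iff]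
  rw [absSpecVec, dif_pos hD]
  refine sumLargest_decrRearrange_le _ hk fun S hS => ?_
  subst hS
  refine le_trans (Finset.sum_le_sum fun i _ => ?_)
    ((sum_doublyStochastic_le (fun l => |hD.eigenvalues l|) (fun l => abs_nonneg _)
      (fun i l => ‖hD.eigenvectorUnitary.1 i l‖ ^ 2) (fun _ _ => by positivity)
      (sum_norm_sq_row _) (sum_norm_sq_col _) S).trans (sum_ite_le_sumLargest _ hk))
  have h : a i = ∑ l, hD.eigenvalues l * ‖hD.eigenvectorUnitary.1 i l‖ ^ 2 := by
    have h := hD.apply_eq_sum_eigenvalues i i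
    simp only [Matrix.diagonal_apply_eq, RCLike.star_def, Complex.mul_conj'] at h
    exact_mod_cast h
  rw [h]
  exact Finset.sum_le_sum fun l _ => by gcongr; exact le_abs_self _

theorem absSpecVec_one {n : ℕ} (i : Fin n) :
    absSpecVec (1 : Matrix (Fin n) (Fin n) ℂ) i = 1 := by
  have h1 : (1 : Matrix (Fin n) (Fin n) ℂ).IsHermitian := Matrix.isHermitian_one
  rw [absSpecVec, dif_pos h1]
  have : ∀ j, h1.eigenvalues j = 1 := fun j => by
    have := Nonempty.intro j
    simpa using h1.eigenvalues_mem_spectrum_real j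
  simp [decrRearrange, this]

theorem schur_product_least_vector (n : ℕ) (A : Matrix (Fin n) (Fin n) ℝ)
    (hA : A.PosSemidef) :
    (∀ X : Matrix (Fin n) (Fin n) ℂ, X.IsHermitian →
      WeakMaj (absSpecVec (Matrix.of fun i j => (A i j : ℂ) * X i j))
        (decrRearrange (fun i => A i i) * absSpecVec X)) ∧
    IsLeastVector (fun X => Matrix.of fun i j => (A i j : ℂ) * X i j)
      (decrRearrange (fun i => A i i)) := by
  refine ⟨fun X hX => weakMaj_absSpecVec_schur hA hX,
    ⟨decrRearrange_antitone _, decrRearrange_nonneg fun i => hA.diag_nonneg⟩,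
    fun X hX => weakMaj_absSpecVec_schur hA hX, fun q' _ h k hk hkn => ?_⟩
  have h1 := h 1 Matrix.isHermitian_one k hk hkn
  have e1 : q' * absSpecVec (1 : Matrix (Fin n) (Fin n) ℂ) = q' := by
    ext i
    simp [absSpecVec_one]
  have e2 : (Matrix.of fun i j => (A i j : ℂ) * (1 : Matrix (Fin n) (Fin n) ℂ) i j) =
      Matrix.diagonal fun i => (A i i : ℂ) := by
    ext i j
    by_cases hij : i = j
    · simp [hij]
    · simp [hij]
  simp only [e1, e2] at h1
  exact (weakMaj_absSpecVec_diagonal _ k hk hkn).trans h1
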